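/- Let d ≥ 1 and let f = f₁/f₀ be a rational function of degree d, with f₁(z) = a₀ + … + a_d z^d and f₀(z) = b₀ + … + b_d z^d coprime, and let H_f = {x ∈ ℂ^{d+1} : Σ aᵢxᵢ = 0 and Σ bᵢxᵢ = 0}. Then for every z₀ ∈ ℂ the following are equivalent: (i) the Wronskian W(f₀,f₁) = f₀f₁′ − f₀′f₁ vanishes at z₀ (i.e. z₀ is a critical point of f); (ii) the tangent line to the rational normal curve at E(z₀) intersects H_f nontrivially, i.e. H_f ∩ span_ℂ{E(z₀), E′(z₀)} ≠ {0}, where E(z) = (1, z, …, z^d) and E′(z) = (0, 1, 2z, …, d·z^{d−1}). -/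

import Mathlib

open Polynomial

/-- The linear form `x ↦ Σ_j p.coeff j * x j` on `ℂ^{d+1}` given by the coefficients of `p`. -/
noncomputable def coeffForm (d : ℕ) (p : ℂ[X]) : (Fin (d + 1) → ℂ) →ₗ[ℂ] ℂ :=
  ∑ j : Fin (d + 1), p.coeff (j : ℕ) • LinearMap.proj j

/-- The codimension-two subspace `H_f ⊆ ℂ^{d+1}` attached to `f = f₁/f₀`. -/
noncomputable def Hsub (d : ℕ) (f₁ f₀ : ℂ[X]) : Submodule ℂ (Fin (d + 1) → ℂ) :=
  LinearMap.ker (coeffForm d f₁) ⊓ LinearMap.ker (coeffForm d f₀)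

/-- The rational normal curve `E(z) = (1, z, z², …, z^d)` in `ℂ^{d+1}`. -/
noncomputable def rncE (d : ℕ) (t : ℂ) : Fin (d + 1) → ℂ := fun j => t ^ (j : ℕ)

/-- Its derivative `E′(z) = (0, 1, 2z, …, d·z^{d−1})`. -/
noncomputable def rncE' (d : ℕ) (t : ℂ) : Fin (d + 1) → ℂ :=
  fun j => ((j : ℕ) : ℂ) * t ^ ((j : ℕ) - 1)

theorem coeffForm_apply (d : ℕ) (p : ℂ[X]) (x : Fin (d + 1) → ℂ) :
    coeffForm d p x = ∑ j : Fin (d + 1), p.coeff (j : ℕ) * x j := by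
  simp [coeffForm]

theorem coeffForm_rncE {d : ℕ} {p : ℂ[X]} (hp : p.degree ≤ d) (t : ℂ) :
    coeffForm d p (rncE d t) = p.eval t := by
  rw [coeffForm_apply,
    eval_eq_sum_range' (Nat.lt_succ_of_le (natDegree_le_of_degree_le hp)),
    ← Fin.sum_univ_eq_sum_range (fun j => p.coeff j * t ^ j)]
  rfl

theorem coeffForm_rncE' {d : ℕ} {p : ℂ[X]} (hp : p.degree ≤ d) (t : ℂ) :
    coeffForm d p (rncE' d t) = (derivative p).eval t := by
  rw [coeffForm_apply, derivative_eval,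
    sum_over_range' p (by simp) (d + 1) (Nat.lt_succ_of_le (natDegree_le_of_degree_le hp)),
    ← Fin.sum_univ_eq_sum_range (fun j => p.coeff j * (j : ℂ) * t ^ (j - 1))]
  exact Finset.sum_congr rfl fun j _ => (mul_assoc _ _ _).symm

/-- `E(t)` and `E′(t)` are linearly independent as soon as `1 ≤ d`. -/
theorem eq_zero_of_smul_rncE_add_smul_rncE' {d : ℕ} (hd : 1 ≤ d) {t a b : ℂ}
    (h : a • rncE d t + b • rncE' d t = 0) : a = 0 ∧ b = 0 := by
  have h₀ := congrFun h ⟨0, by omega⟩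
  have h₁ := congrFun h ⟨1, by omega⟩
  simp only [rncE, rncE', Pi.add_apply, Pi.smul_apply, Pi.zero_apply, smul_eq_mul, pow_zero,
    pow_one, Nat.cast_zero, Nat.cast_one, zero_mul, mul_zero, mul_one, add_zero,
    Nat.sub_self] at h₀ h₁
  subst h₀
  simpa using h₁

theorem smul_rncE_add_smul_rncE'_mem_Hsub_iff {d : ℕ} {f₁ f₀ : ℂ[X]} (h₁ : f₁.degree ≤ d)
    (h₀ : f₀.degree ≤ d) (t a b : ℂ) :
    a • rncE d t + b • rncE' d t ∈ Hsub d f₁ f₀ ↔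
      a * f₁.eval t + b * (derivative f₁).eval t = 0 ∧
        a * f₀.eval t + b * (derivative f₀).eval t = 0 := by
  simp [Hsub, coeffForm_rncE h₁, coeffForm_rncE h₀, coeffForm_rncE' h₁, coeffForm_rncE' h₀]

/-- **Critical points and tangent lines (Section 1).** For a rational function `f = f₁/f₀` of
degree `d` and `z₀ ∈ ℂ`, the Wronskian `W(f₀,f₁) = f₀f₁′ − f₀′f₁` vanishes at `z₀` (i.e. `z₀`
is a critical point of `f`) if and only if the tangent line `span{E(z₀), E′(z₀)}` to the
rational normal curve intersects `H_f` nontrivially. -/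
theorem critical_point_iff_tangent_line_meets (d : ℕ) (hd : 1 ≤ d)
    (f₁ f₀ : ℂ[X]) (hcop : IsCoprime f₁ f₀)
    (hdeg : max f₁.degree f₀.degree = (d : ℕ)) (z₀ : ℂ) :
    (f₀ * derivative f₁ - derivative f₀ * f₁).eval z₀ = 0 ↔
      Hsub d f₁ f₀ ⊓ Submodule.span ℂ {rncE d z₀, rncE' d z₀} ≠ ⊥ := by
  have h₁ : f₁.degree ≤ d := hdeg ▸ le_max_left _ _
  have h₀ : f₀.degree ≤ d := hdeg ▸ le_max_right _ _
  have hne : f₁.eval z₀ ≠ 0 ∨ f₀.eval z₀ ≠ 0 := by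
    by_contra! h
    obtain ⟨r, s, hrs⟩ := hcop
    simpa [h.1, h.2] using congrArg (eval z₀) hrs
  rw [Submodule.ne_bot_iff]
  simp only [eval_sub, eval_mul]
  constructor
  · intro hW
    obtain ⟨a, b, hb, hmem⟩ : ∃ a b : ℂ, b ≠ 0 ∧
        a • rncE d z₀ + b • rncE' d z₀ ∈ Hsub d f₁ f₀ := by
      simp only [smul_rncE_add_smul_rncE'_mem_Hsub_iff h₁ h₀]
      rcases hne with h | h
      · exact ⟨-(derivative f₁).eval z₀, f₁.eval z₀, h, by ring, by linear_combination -hW⟩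
      · exact ⟨-(derivative f₀).eval z₀, f₀.eval z₀, h, by linear_combination hW, by ring⟩
    exact ⟨_, ⟨hmem, Submodule.mem_span_pair.2 ⟨a, b, rfl⟩⟩,
      fun h => hb (eq_zero_of_smul_rncE_add_smul_rncE' hd h).2⟩
  · rintro ⟨x, ⟨hH, hspan⟩, hx⟩
    obtain ⟨a, b, rfl⟩ := Submodule.mem_span_pair.1 hspan
    obtain ⟨e₁, e₀⟩ := (smul_rncE_add_smul_rncE'_mem_Hsub_iff h₁ h₀ z₀ a b).1 hH
    have hb : b ≠ 0 := by
      rintro rfl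
      have ha : a = 0 := by
        rcases hne with h | h
        · simpa [h] using e₁
        · simpa [h] using e₀
      simp [ha] at hx
    refine (mul_eq_zero.1 ?_).resolve_left hb
    linear_combination f₀.eval z₀ * e₁ - f₁.eval z₀ * e₀
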